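/- Estimate for the BBGKY remainder term: Let ε ∈ (0,1), N ≥ M/ε and s ≤ N. Define the remainder operator R^N_{s,s+k} := Σ_{n=2}^{M−k} β_{k+n} (N/binom(N,k+n)) binom(N−s,k) Σ_{1≤i_1<⋯<i_n≤s} C^{s,k+n,n}_{i_1⋯i_n}. Then its operator norm satisfies ‖R^N_{s,s+k}‖ ≤ C_k · s²/N, where C_k := 2 Σ_{ℓ=k+2}^M (1−ε)^{−ℓ} β_ℓ binom(ℓ,k). -/

import Mathlib

open MeasureTheory Filter Finset
open scoped Classical

noncomputable section

/-- The single-particle velocity space `ℝ^d`. -/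
abbrev ESp (d : ℕ) := EuclideanSpace ℝ (Fin d)

/-- Action of a permutation of `{1,…,K}` on `ℝ^{dK}`, permuting the `K` blocks of `ℝ^d`:
`σ(V)_i = V_{σ(i)}`. -/
def permAct {d K : ℕ} (σ : Equiv.Perm (Fin K)) (V : Fin K → ESp d) : Fin K → ESp d :=
  fun i => V (σ i)

/-- `f` is invariant under permutations of its `n` blocks of `d` variables. -/
def SymFun {d n : ℕ} (f : (Fin n → ESp d) → ℝ) : Prop :=
  ∀ σ : Equiv.Perm (Fin n), ∀ V : Fin n → ESp d, f (fun j => V (σ j)) = f V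

/-- Extension `T^ω_{i_1⋯i_K}` of a `K`-particle map to `N` particles: the particles labelled by
`ι` collide according to `Tω`, the others are untouched. -/
def extendMap {d K N : ℕ} (Tω : (Fin K → ESp d) → Fin K → ESp d)
    (ι : Fin K → Fin N) (V : Fin N → ESp d) : Fin N → ESp d :=
  fun j => if h : ∃ a, ι a = j then Tω (fun a => V (ι a)) h.choose else V j

/-- **(H1)**: each `T_K^ω` conserves kinetic energy (is an isometry of `ℝ^{dK}`). -/
def KacH1 (d M : ℕ) (S : ℕ → Type*)
    (T : ∀ K, S K → (Fin K → ESp d) ≃ₗ[ℝ] (Fin K → ESp d)) : Prop :=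
  ∀ K, 1 ≤ K → K ≤ M → ∀ ω : S K, ∀ V : Fin K → ESp d,
    ∑ i : Fin K, ‖T K ω V i‖ ^ 2 = ∑ i : Fin K, ‖V i‖ ^ 2

/-- **(H2)**: on average over the collision kernel, `T_K` is an involution. -/
def KacH2 (d M : ℕ) (S : ℕ → Type*) [∀ K, MeasurableSpace (S K)]
    (b : ∀ K, Measure (S K))
    (T : ∀ K, S K → (Fin K → ESp d) ≃ₗ[ℝ] (Fin K → ESp d)) : Prop :=
  ∀ K, 1 ≤ K → K ≤ M → ∀ φ : (Fin K → ESp d) → ℝ, Continuous φ →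
    ∀ V : Fin K → ESp d,
      ∫ ω, φ ((T K ω).symm V) ∂(b K) = ∫ ω, φ (T K ω V) ∂(b K)

/-- **(H3)**: on average over the collision kernel, `T_K` is invariant under relabelling of the
particles: `∫ φ((σ∘T_K^ω∘σ⁻¹)V) db_K = ∫ φ(T_K^ω V) db_K`. -/
def KacH3 (d M : ℕ) (S : ℕ → Type*) [∀ K, MeasurableSpace (S K)]
    (b : ∀ K, Measure (S K))
    (T : ∀ K, S K → (Fin K → ESp d) ≃ₗ[ℝ] (Fin K → ESp d)) : Prop :=
  ∀ K, 1 ≤ K → K ≤ M → ∀ σ : Equiv.Perm (Fin K), ∀ φ : (Fin K → ESp d) → ℝ, Continuous φ →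
    ∀ V : Fin K → ESp d,
      ∫ ω, φ (permAct σ (T K ω (permAct σ⁻¹ V))) ∂(b K) = ∫ ω, φ (T K ω V) ∂(b K)

/-- Joint measurability of the transformation laws. -/
def KacMeas (d : ℕ) (S : ℕ → Type*) [∀ K, MeasurableSpace (S K)]
    (T : ∀ K, S K → (Fin K → ESp d) ≃ₗ[ℝ] (Fin K → ESp d)) : Prop :=
  ∀ K, Measurable (fun p : S K × (Fin K → ESp d) => T K p.1 p.2)

/-- The operator `Ω_{i_1⋯i_K} f = ∫_{S_K} (f∘T^ω_{i_1⋯i_K} − f) db_K(ω)`. -/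
def OmegaIdx {d : ℕ} {S : ℕ → Type*} [∀ K, MeasurableSpace (S K)]
    (b : ∀ K, Measure (S K))
    (T : ∀ K, S K → (Fin K → ESp d) ≃ₗ[ℝ] (Fin K → ESp d))
    (K N : ℕ) (ι : Fin K → Fin N) (f : (Fin N → ESp d) → ℝ) : (Fin N → ESp d) → ℝ :=
  fun V => ∫ ω, (f (extendMap (⇑(T K ω)) ι V) - f V) ∂(b K)

/-- The index map selecting the slots `i_1,…,i_n, s+1,…,s+r` among `s + r` particles. -/
def collIdx (s n r K : ℕ) (hK : K = n + r) (i : Fin n → Fin s) : Fin K → Fin (s + r) :=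
  fun a =>
    if h : (a : ℕ) < n then Fin.castLE (Nat.le_add_right s r) (i ⟨a, h⟩)
    else ⟨s + ((a : ℕ) - n), by have := a.isLt; omega⟩

/-- The collision operator `C^{s,K,n}_{i_1⋯i_n} : L¹_sym(ℝ^{d(s+r)}) → L¹_sym(ℝ^{ds})`,
`r = K − n`, from Definition 6.1 of the paper. -/
def collOp {d : ℕ} {S : ℕ → Type*} [∀ K, MeasurableSpace (S K)]
    (b : ∀ K, Measure (S K))
    (T : ∀ K, S K → (Fin K → ESp d) ≃ₗ[ℝ] (Fin K → ESp d))
    (s n r K : ℕ) (hK : K = n + r) (i : Fin n → Fin s)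
    (g : (Fin (s + r) → ESp d) → ℝ) : (Fin s → ESp d) → ℝ :=
  fun V => ∫ p : S K × (Fin r → ESp d),
    (g (extendMap (⇑(T K p.1)) (collIdx s n r K hK i) (Fin.append V p.2)) -
      g (Fin.append V p.2)) ∂((b K).prod volume)

/-- The marginal (partial trace) `Tr_{j+1,…,N} f` of an `N`-particle density; it is the zero
function for `j > N`. -/
def margOf {d : ℕ} (N j : ℕ) (f : (Fin N → ESp d) → ℝ) : (Fin j → ESp d) → ℝ :=
  if h : j ≤ N then
    fun V => ∫ w : Fin (N - j) → ESp d, f (fun a => Fin.append V w (Fin.cast (by omega) a))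
  else 0

/-- The BBGKY-hierarchy operator
`C^N_{s,s+k} = Σ_{n=1}^{M−k} β_{k+n} (N/binom(N,k+n)) binom(N−s,k)
  Σ_{i_1<⋯<i_n≤s} C^{s,k+n,n}_{i_1⋯i_n}` (zero when `s + k > N`). -/
def bbgkyC {d : ℕ} {S : ℕ → Type*} [∀ K, MeasurableSpace (S K)]
    (b : ∀ K, Measure (S K))
    (T : ∀ K, S K → (Fin K → ESp d) ≃ₗ[ℝ] (Fin K → ESp d))
    (M : ℕ) (β : ℕ → ℝ) (N s k : ℕ)
    (g : (Fin (s + k) → ESp d) → ℝ) : (Fin s → ESp d) → ℝ :=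
  fun V =>
    if s + k ≤ N then
      ∑ n ∈ Finset.Icc 1 (M - k),
        β (k + n) * ((N : ℝ) / (N.choose (k + n) : ℝ)) * ((N - s).choose k : ℝ) *
          ∑ i : Fin n → Fin s,
            (if StrictMono i then collOp b T s n k (k + n) (by omega) i g V else 0)
    else 0

/-- The Boltzmann-hierarchy operator
`(C^∞_{s,s+k} g)(V_s) = β_{k+1}(k+1) Σ_{i=1}^s ∫ (g(V^{*i}_{s+k}) − g(V_{s+k})) db dv`. -/
def boltzC {d : ℕ} {S : ℕ → Type*} [∀ K, MeasurableSpace (S K)]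
    (b : ∀ K, Measure (S K))
    (T : ∀ K, S K → (Fin K → ESp d) ≃ₗ[ℝ] (Fin K → ESp d))
    (β : ℕ → ℝ) (s k : ℕ)
    (g : (Fin (s + k) → ESp d) → ℝ) : (Fin s → ESp d) → ℝ :=
  fun V => β (k + 1) * ((k : ℝ) + 1) *
    ∑ i : Fin s, collOp b T s 1 k (k + 1) (by omega) (fun _ => i) g V

/-- The generator `Ω` of the Master equation of the generalized Kac model. -/
def masterGen {d : ℕ} {S : ℕ → Type*} [∀ K, MeasurableSpace (S K)]
    (b : ∀ K, Measure (S K))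
    (T : ∀ K, S K → (Fin K → ESp d) ≃ₗ[ℝ] (Fin K → ESp d))
    (M : ℕ) (β : ℕ → ℝ) (N : ℕ)
    (f : (Fin N → ESp d) → ℝ) : (Fin N → ESp d) → ℝ :=
  fun V => (N : ℝ) * ∑ K ∈ Finset.Icc 1 M,
    β K * (1 / ((K.factorial : ℝ) * (N.choose K : ℝ))) *
      ∑ ι : Fin K → Fin N,
        (if Function.Injective ι then OmegaIdx b T K N ι f V else 0)

/-- The solution `e^{tΩ} f₀` of the Master equation, as a pointwise exponential series. -/
def masterSol {d : ℕ} {S : ℕ → Type*} [∀ K, MeasurableSpace (S K)]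
    (b : ∀ K, Measure (S K))
    (T : ∀ K, S K → (Fin K → ESp d) ≃ₗ[ℝ] (Fin K → ESp d))
    (M : ℕ) (β : ℕ → ℝ) (N : ℕ)
    (f₀ : (Fin N → ESp d) → ℝ) (t : ℝ) : (Fin N → ESp d) → ℝ :=
  fun V => ∑' n : ℕ, (t ^ n / (n.factorial : ℝ)) * (masterGen b T M β N)^[n] f₀ V

/-- `f` has `g` as derivative at time `t` in the `L¹(μ)` sense. -/
def HasL1DerivAt {α : Type*} [MeasurableSpace α] (μ : Measure α)
    (f : ℝ → α → ℝ) (g : α → ℝ) (t : ℝ) : Prop :=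
  Tendsto (fun h : ℝ => ∫ x, |(f (t + h) x - f t x) / h - g x| ∂μ)
    (nhdsWithin 0 {(0 : ℝ)}ᶜ) (nhds 0)

/-- A bounded measurable test function (an element of `L^∞`). -/
def BddMeas {α : Type*} [MeasurableSpace α] (φ : α → ℝ) : Prop :=
  Measurable φ ∧ ∃ C : ℝ, ∀ x, |φ x| ≤ C

end

/-- The remainder part `R^N_{s,s+k}` of the BBGKY operator: the contribution of the terms with
`n ≥ 2`. -/
noncomputable def bbgkyR {d : ℕ} {S : ℕ → Type*} [∀ K, MeasurableSpace (S K)]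
    (b : ∀ K, Measure (S K))
    (T : ∀ K, S K → (Fin K → ESp d) ≃ₗ[ℝ] (Fin K → ESp d))
    (M : ℕ) (β : ℕ → ℝ) (N s k : ℕ)
    (g : (Fin (s + k) → ESp d) → ℝ) : (Fin s → ESp d) → ℝ :=
  fun V =>
    if s + k ≤ N then
      ∑ n ∈ Finset.Icc 2 (M - k),
        β (k + n) * ((N : ℝ) / (N.choose (k + n) : ℝ)) * ((N - s).choose k : ℝ) *
          ∑ i : Fin n → Fin s,
            (if StrictMono i then collOp b T s n k (k + n) (by omega) i g V else 0)
    else 0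

section ExtendMap

variable {d K N : ℕ}

/-- A slot `ι a` taking part in the collision receives the `a`-th outgoing velocity. -/
lemma extendMap_apply_image (Tω : (Fin K → ESp d) → Fin K → ESp d) {ι : Fin K → Fin N}
    (hι : Function.Injective ι) (V : Fin N → ESp d) (a : Fin K) :
    extendMap Tω ι V (ι a) = Tω (fun c => V (ι c)) a := by
  have h : ∃ c, ι c = ι a := ⟨a, rfl⟩
  simp only [extendMap, dif_pos h]
  rw [hι h.choose_spec]

/-- A slot outside the range of `ι` is left untouched. -/
lemma extendMap_apply_of_notMem (Tω : (Fin K → ESp d) → Fin K → ESp d) {ι : Fin K → Fin N}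
    (V : Fin N → ESp d) {j : Fin N} (hj : ¬ ∃ a, ι a = j) : extendMap Tω ι V j = V j := by
  simp only [extendMap, dif_neg hj]

/-- The extension conserves the total kinetic energy when the collision does. -/
lemma sum_norm_sq_extendMap {Tω : (Fin K → ESp d) → Fin K → ESp d}
    (hT : ∀ V, ∑ i, ‖Tω V i‖ ^ 2 = ∑ i, ‖V i‖ ^ 2) {ι : Fin K → Fin N}
    (hι : Function.Injective ι) (V : Fin N → ESp d) :
    ∑ j, ‖extendMap Tω ι V j‖ ^ 2 = ∑ j, ‖V j‖ ^ 2 := by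
  rw [← Finset.sum_add_sum_compl (Finset.univ.image ι),
    ← Finset.sum_add_sum_compl (Finset.univ.image ι) fun j => ‖V j‖ ^ 2,
    Finset.sum_image hι.injOn, Finset.sum_image hι.injOn]
  congr 1
  · simp only [extendMap_apply_image Tω hι]
    exact hT fun c => V (ι c)
  · refine Finset.sum_congr rfl fun j hj => ?_
    rw [extendMap_apply_of_notMem]
    simpa using hj

/-- The extension of a linear collision, as a linear map. -/
noncomputable def extendLinear (L : (Fin K → ESp d) →ₗ[ℝ] (Fin K → ESp d)) (ι : Fin K → Fin N) :
    (Fin N → ESp d) →ₗ[ℝ] (Fin N → ESp d) where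
  toFun := extendMap L ι
  map_add' V W := by
    funext j
    by_cases h : ∃ a, ι a = j
    · simp only [extendMap, dif_pos h, Pi.add_apply]
      exact congrFun (L.map_add (fun a => V (ι a)) fun a => W (ι a)) _
    · simp only [extendMap, dif_neg h, Pi.add_apply]
  map_smul' c V := by
    funext j
    by_cases h : ∃ a, ι a = j
    · simp only [extendMap, dif_pos h, Pi.smul_apply]
      exact congrFun (L.map_smul c fun a => V (ι a)) _
    · simp only [extendMap, dif_neg h, Pi.smul_apply, RingHom.id_apply]

/-- Joint measurability of the extension in the collision parameter and the velocities. -/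
lemma measurable_extendMap {Ω : Type*} [MeasurableSpace Ω]
    {T : Ω → (Fin K → ESp d) → Fin K → ESp d}
    (hT : Measurable fun p : Ω × (Fin K → ESp d) => T p.1 p.2) (ι : Fin K → Fin N) :
    Measurable fun p : Ω × (Fin N → ESp d) => extendMap (T p.1) ι p.2 := by
  refine measurable_pi_lambda _ fun j => ?_
  by_cases h : ∃ a, ι a = j
  · simp only [extendMap, dif_pos h]
    have hsel : Measurable fun p : Ω × (Fin N → ESp d) => (p.1, fun a => p.2 (ι a)) := by
      fun_prop
    exact (measurable_pi_apply _).comp (hT.comp hsel)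
  · simp only [extendMap, dif_neg h]
    fun_prop

end ExtendMap

/-- A linear map of `ℝ^{dm}` conserving the kinetic energy preserves Lebesgue measure. -/
lemma measurePreserving_of_sum_norm_sq_eq {d m : ℕ}
    (L : (Fin m → ESp d) →ₗ[ℝ] (Fin m → ESp d))
    (hL : ∀ V, ∑ i, ‖L V i‖ ^ 2 = ∑ i, ‖V i‖ ^ 2) :
    MeasurePreserving L volume volume := by
  have hinj : Function.Injective L := by
    rw [injective_iff_map_eq_zero]
    intro V hV
    have h := hL V
    simp only [hV, Pi.zero_apply, norm_zero, ne_eq, OfNat.ofNat_ne_zero, not_false_eq_true,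
      zero_pow, Finset.sum_const_zero] at h
    funext i
    have hi := (Finset.sum_eq_zero_iff_of_nonneg fun i _ => sq_nonneg ‖V i‖).1 h.symm i
      (Finset.mem_univ i)
    simpa using hi
  have hdet : LinearMap.det L ≠ 0 :=
    ((LinearEquiv.ofInjectiveEndo L hinj).isUnit_det').ne_zero
  let B : Set (Fin m → ESp d) := {V | ∑ i, ‖V i‖ ^ 2 < 1}
  have hBpre : L ⁻¹' B = B := by
    ext V
    simp [B, hL]
  have hBopen : IsOpen B := isOpen_lt (by fun_prop) continuous_const
  have hBpos : volume B ≠ 0 := (hBopen.measure_pos volume ⟨0, by simp [B]⟩).ne'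
  have hBfin : volume B ≠ ⊤ := by
    refine ne_top_of_le_ne_top (measure_closedBall_lt_top (x := 0) (r := 1)).ne
      (measure_mono fun V hV => ?_)
    rw [mem_closedBall_zero_iff, pi_norm_le_iff_of_nonneg zero_le_one]
    intro i
    have hle : ‖V i‖ ^ 2 ≤ ∑ j, ‖V j‖ ^ 2 :=
      Finset.single_le_sum (f := fun j => ‖V j‖ ^ 2) (fun j _ => sq_nonneg _) (Finset.mem_univ i)
    exact (sq_le_one_iff₀ (norm_nonneg _)).1 (hle.trans (le_of_lt hV))
  have hscale : ENNReal.ofReal |(LinearMap.det L)⁻¹| = 1 := by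
    have h := Measure.addHaar_preimage_linearMap volume hdet B
    rw [hBpre] at h
    exact (ENNReal.mul_eq_right hBpos hBfin).1 h.symm
  refine ⟨L.continuous_of_finiteDimensional.measurable, ?_⟩
  rw [Measure.map_linearMap_addHaar_eq_smul_addHaar volume hdet, hscale, one_smul]

/-- Concatenation of velocity vectors preserves Lebesgue measure. -/
lemma measurePreserving_finAppend (d s r : ℕ) :
    MeasurePreserving
      (fun p : (Fin s → ESp d) × (Fin r → ESp d) => Fin.append p.1 p.2) volume volume := by
  have h := (volume_measurePreserving_piCongrLeft (fun _ : Fin (s + r) => ESp d)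
    finSumFinEquiv).comp
      (volume_measurePreserving_sumPiEquivProdPi_symm fun _ : Fin s ⊕ Fin r => ESp d)
  convert h using 1
  funext p j
  obtain ⟨x, rfl⟩ := finSumFinEquiv.surjective j
  rw [Function.comp_apply, MeasurableEquiv.piCongrLeft_apply_apply]
  cases x <;> simp [MeasurableEquiv.sumPiEquivProdPi, Equiv.sumPiEquivProdPi]

/-- Concatenation, carrying an auxiliary parameter along, is measure preserving. -/
lemma measurePreserving_param_append {Ω : Type*} [MeasurableSpace Ω] (b : Measure Ω)
    [IsProbabilityMeasure b] (d s r : ℕ) :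
    MeasurePreserving
      (fun q : (Fin s → ESp d) × (Ω × (Fin r → ESp d)) => (q.2.1, Fin.append q.1 q.2.2))
      ((volume : Measure (Fin s → ESp d)).prod (b.prod volume)) (b.prod volume) := by
  have hswap : MeasurePreserving (Prod.swap : (Fin r → ESp d) × (Fin s → ESp d) → _)
      (volume.prod volume) (volume.prod volume) := Measure.measurePreserving_swap
  exact ((MeasurePreserving.id b).prod ((measurePreserving_finAppend d s r).comp hswap)).comp
    ((measurePreserving_prodAssoc b volume volume).comp Measure.measurePreserving_swap)

/-- The collision slots are pairwise distinct. -/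
lemma collIdx_injective {s n r K : ℕ} (hK : K = n + r) {i : Fin n → Fin s}
    (hi : Function.Injective i) : Function.Injective (collIdx s n r K hK i) := by
  intro a c hac
  simp only [collIdx] at hac
  split_ifs at hac with ha hc hc
  · have h := hi (Fin.castLE_injective _ hac)
    simp only [Fin.mk.injEq] at h
    exact Fin.ext h
  · have h := congrArg Fin.val hac
    have := (i ⟨a, ha⟩).isLt
    simp only [Fin.val_castLE] at h
    omega
  · have h := congrArg Fin.val hac
    have := (i ⟨c, hc⟩).isLt
    simp only [Fin.val_castLE] at h
    omega
  · simp only [Fin.mk.injEq] at hac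
    exact Fin.ext (by omega)

/-- If both `φ` and `ψ` preserve measure, integrating `g ∘ φ - g ∘ ψ` over the second variable
is an operator on `L¹` of norm at most `2`. -/
lemma integrable_integral_comp_sub_comp {α γ δ : Type*} [MeasurableSpace α] [MeasurableSpace γ]
    [MeasurableSpace δ] {μ : Measure α} {ν : Measure γ} {ρ : Measure δ} [SFinite μ] [SFinite ν]
    {φ ψ : α × γ → δ} (hφ : MeasurePreserving φ (μ.prod ν) ρ)
    (hψ : MeasurePreserving ψ (μ.prod ν) ρ) {g : δ → ℝ} (hg : Integrable g ρ) :
    Integrable (fun x => ∫ y, (g (φ (x, y)) - g (ψ (x, y))) ∂ν) μ ∧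
      ∫ x, |∫ y, (g (φ (x, y)) - g (ψ (x, y))) ∂ν| ∂μ ≤ 2 * ∫ z, |g z| ∂ρ := by
  have hcomp : ∀ {χ : α × γ → δ}, MeasurePreserving χ (μ.prod ν) ρ →
      Integrable (fun q => g (χ q)) (μ.prod ν) ∧ ∫ q, |g (χ q)| ∂(μ.prod ν) = ∫ z, |g z| ∂ρ := by
    intro χ hχ
    refine ⟨hχ.integrable_comp_of_integrable hg, ?_⟩
    rw [← hχ.map_eq, integral_map hχ.aemeasurable]
    rw [hχ.map_eq]
    exact hg.abs.aestronglyMeasurable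
  obtain ⟨hφi, hφn⟩ := hcomp hφ
  obtain ⟨hψi, hψn⟩ := hcomp hψ
  have hF := hφi.sub hψi
  refine ⟨hF.integral_prod_left, ?_⟩
  calc ∫ x, |∫ y, (g (φ (x, y)) - g (ψ (x, y))) ∂ν| ∂μ
      ≤ ∫ x, ∫ y, |g (φ (x, y)) - g (ψ (x, y))| ∂ν ∂μ :=
        integral_mono hF.integral_prod_left.abs hF.abs.integral_prod_left
          fun x => abs_integral_le_integral_abs
    _ = ∫ q, |g (φ q) - g (ψ q)| ∂(μ.prod ν) :=
        (integral_prod (fun q => |g (φ q) - g (ψ q)|) hF.abs).symm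
    _ ≤ ∫ q, (|g (φ q)| + |g (ψ q)|) ∂(μ.prod ν) :=
        integral_mono hF.abs (hφi.abs.add hψi.abs) fun q => abs_sub _ _
    _ = 2 * ∫ z, |g z| ∂ρ := by
        rw [integral_add hφi.abs hψi.abs, hφn, hψn, two_mul]

/-- Each collision operator is bounded on `L¹` with norm at most `2`. -/
lemma integrable_collOp {d M : ℕ} {S : ℕ → Type*} [∀ K, MeasurableSpace (S K)]
    {b : ∀ K, Measure (S K)} [∀ K, IsProbabilityMeasure (b K)]
    {T : ∀ K, S K → (Fin K → ESp d) ≃ₗ[ℝ] (Fin K → ESp d)}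
    (hmeas : KacMeas d S T) (h1 : KacH1 d M S T) {s n r K : ℕ} (hK : K = n + r)
    (hK1 : 1 ≤ K) (hKM : K ≤ M) {i : Fin n → Fin s} (hi : Function.Injective i)
    {g : (Fin (s + r) → ESp d) → ℝ} (hg : Integrable g) :
    Integrable (collOp b T s n r K hK i g) ∧
      ∫ V, |collOp b T s n r K hK i g V| ≤ 2 * ∫ W, |g W| := by
  have hι := collIdx_injective hK hi
  have hcoll : MeasurePreserving
      (fun p : S K × (Fin (s + r) → ESp d) =>
        (p.1, extendMap (⇑(T K p.1)) (collIdx s n r K hK i) p.2))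
      ((b K).prod volume) ((b K).prod volume) := by
    refine (MeasurePreserving.id (b K)).skew_product
      (g := fun ω => extendMap (⇑(T K ω)) (collIdx s n r K hK i))
      (measurable_extendMap (T := fun ω => ⇑(T K ω)) (hmeas K) _) (ae_of_all _ fun ω => ?_)
    exact (measurePreserving_of_sum_norm_sq_eq
      (extendLinear (T K ω : (Fin K → ESp d) →ₗ[ℝ] (Fin K → ESp d)) (collIdx s n r K hK i))
      (sum_norm_sq_extendMap (h1 K hK1 hKM ω) hι)).map_eq
  have happ := measurePreserving_param_append (b K) d s r
  exact integrable_integral_comp_sub_comp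
    (measurePreserving_snd.comp (hcoll.comp happ)) (measurePreserving_snd.comp happ) hg

/-- There are at most `binom(s,n)` strictly increasing maps from `Fin n` to `Fin s`. -/
lemma card_strictMono_le_choose (n s : ℕ) :
    (Finset.univ.filter fun i : Fin n → Fin s => StrictMono i).card ≤ s.choose n := by
  calc (Finset.univ.filter fun i : Fin n → Fin s => StrictMono i).card
      ≤ (Finset.powersetCard n (Finset.univ : Finset (Fin s))).card := by
        refine Finset.card_le_card_of_injOn (fun i => Finset.univ.image i) ?_ ?_
        · intro i hi
          have hi' : StrictMono i := by simpa using hi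
          simp [Finset.mem_powersetCard, Finset.card_image_of_injective _ hi'.injective]
        · intro i hi j hj hij
          have hi' : StrictMono i := by simpa using hi
          have hj' : StrictMono j := by simpa using hj
          refine (hi'.range_inj hj').1 ?_
          have h := congrArg (fun t : Finset (Fin s) => (t : Set (Fin s))) hij
          simpa using h
    _ = s.choose n := by simp

/-- Comparison of the combinatorial weight of an `n`-fold collision with `s² / N`. -/
lemma choose_weight_le {N s k n : ℕ} {ε : ℝ} (hε1 : ε < 1) (hN : 0 < N)
    (hℓ : ((k + n : ℕ) : ℝ) ≤ ε * N) (hsN : s ≤ N) (hn : 2 ≤ n) :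
    (N : ℝ) / (N.choose (k + n) : ℝ) * ((N - s).choose k : ℝ) * (s.choose n : ℝ) ≤
      ((1 - ε) ^ (k + n))⁻¹ * ((k + n).choose k : ℝ) * ((s : ℝ) ^ 2 / N) := by
  have hNpos : (0 : ℝ) < N := by exact_mod_cast hN
  have hε : 0 < 1 - ε := by linarith
  have hℓN : k + n ≤ N := by
    have : ((k + n : ℕ) : ℝ) ≤ N := hℓ.trans (by nlinarith)
    exact_mod_cast this
  have hlow : ((1 - ε) * N) ^ (k + n) ≤ (N.descFactorial (k + n) : ℝ) := by
    calc ((1 - ε) * N) ^ (k + n) ≤ ((N + 1 - (k + n) : ℕ) : ℝ) ^ (k + n) := by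
          refine pow_le_pow_left₀ (by positivity) ?_ _
          rw [Nat.cast_sub (by omega)]
          push_cast at hℓ ⊢
          linarith
      _ ≤ _ := by exact_mod_cast Nat.pow_sub_le_descFactorial N (k + n)
  have hk : ((N - s).descFactorial k : ℝ) ≤ (N : ℝ) ^ k := by
    exact_mod_cast (Nat.descFactorial_le_pow _ _).trans (Nat.pow_le_pow_left (Nat.sub_le N s) k)
  have hs : (s.descFactorial n : ℝ) ≤ (s : ℝ) ^ 2 * (N : ℝ) ^ (n - 2) := by
    have h : s.descFactorial n ≤ s ^ 2 * N ^ (n - 2) := by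
      calc s.descFactorial n ≤ s ^ n := Nat.descFactorial_le_pow _ _
        _ = s ^ 2 * s ^ (n - 2) := by rw [← pow_add]; congr 1; omega
        _ ≤ _ := Nat.mul_le_mul_left _ (Nat.pow_le_pow_left hsN _)
    exact_mod_cast h
  rw [Nat.descFactorial_eq_factorial_mul_choose, Nat.cast_mul] at hlow hk hs
  have hfac : ((k + n).choose k : ℝ) * k.factorial * n.factorial = (k + n).factorial := by
    rw [Nat.choose_symm_add]
    exact_mod_cast Nat.add_choose_mul_factorial_mul_factorial k n
  have hc : (0 : ℝ) < N.choose (k + n) := by exact_mod_cast Nat.choose_pos hℓN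
  have hkf : (0 : ℝ) < k.factorial := by exact_mod_cast k.factorial_pos
  have hnf : (0 : ℝ) < n.factorial := by exact_mod_cast n.factorial_pos
  have hb : (0 : ℝ) ≤ (k + n).choose k := Nat.cast_nonneg _
  have hnum := mul_le_mul hk hs (by positivity) (by positivity)
  have hpow : (N : ℝ) ^ (k + n) = (N : ℝ) ^ k * ((N : ℝ) ^ (n - 2) * (N : ℝ) ^ 2) := by
    rw [← pow_add, ← pow_add]; congr 1; omega
  rw [← hfac, mul_pow, hpow] at hlow
  have hrhs : ((1 - ε) ^ (k + n))⁻¹ * ((k + n).choose k : ℝ) * ((s : ℝ) ^ 2 / N) =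
      ((k + n).choose k : ℝ) * (s : ℝ) ^ 2 / ((1 - ε) ^ (k + n) * N) := by
    field_simp
  have hlhs : (N : ℝ) / (N.choose (k + n) : ℝ) * ((N - s).choose k : ℝ) * (s.choose n : ℝ) =
      (N * ((N - s).choose k : ℝ) * (s.choose n : ℝ)) / N.choose (k + n) := by
    ring
  rw [hrhs, hlhs, div_le_div_iff₀ hc (by positivity)]
  have hQ : (0 : ℝ) < (k.factorial : ℝ) * n.factorial * ((N : ℝ) ^ k * (N : ℝ) ^ (n - 2)) := by
    positivity
  refine le_of_mul_le_mul_right ?_ hQ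
  calc (N * ((N - s).choose k : ℝ) * (s.choose n : ℝ)) * ((1 - ε) ^ (k + n) * N) *
        ((k.factorial : ℝ) * n.factorial * ((N : ℝ) ^ k * (N : ℝ) ^ (n - 2)))
      = (k.factorial * ((N - s).choose k : ℝ) * (n.factorial * (s.choose n : ℝ))) *
        ((1 - ε) ^ (k + n) * ((N : ℝ) ^ k * ((N : ℝ) ^ (n - 2) * (N : ℝ) ^ 2))) := by ring
    _ ≤ ((N : ℝ) ^ k * ((s : ℝ) ^ 2 * (N : ℝ) ^ (n - 2))) *
        (((k + n).choose k : ℝ) * k.factorial * n.factorial * N.choose (k + n)) :=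
        mul_le_mul hnum hlow (by positivity) (by positivity)
    _ = _ := by ring

/-- **Estimate for the BBGKY remainder term** (proof of Lemma 6.5 in the paper). For
`ε ∈ (0,1)`, `N ≥ M/ε` and `s ≤ N`, the remainder operator satisfies
`‖R^N_{s,s+k}‖ ≤ C_k s²/N` with `C_k = 2 Σ_{ℓ=k+2}^M (1−ε)^{−ℓ} β_ℓ binom(ℓ,k)`. -/
theorem stmt9 (d M : ℕ) (S : ℕ → Type*) [∀ K, MeasurableSpace (S K)]
    (b : ∀ K, Measure (S K)) [∀ K, IsProbabilityMeasure (b K)]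
    (T : ∀ K, S K → (Fin K → ESp d) ≃ₗ[ℝ] (Fin K → ESp d))
    (hmeas : KacMeas d S T)
    (h1 : KacH1 d M S T) (h2 : KacH2 d M S b T) (h3 : KacH3 d M S b T)
    (β : ℕ → ℝ) (hβ : ∀ K, 0 ≤ β K) (hβ1 : ∑ K ∈ Finset.Icc 1 M, β K = 1)
    (N : ℕ) (ε : ℝ) (hε0 : 0 < ε) (hε1 : ε < 1) (hMN : (M : ℝ) / ε ≤ (N : ℝ))
    (s k : ℕ) (hsN : s ≤ N)
    (g : (Fin (s + k) → ESp d) → ℝ) (hg : Integrable g) (hgsym : SymFun g) :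
    ∫ V, |bbgkyR b T M β N s k g V| ≤
      (2 * ∑ ℓ ∈ Finset.Icc (k + 2) M, ((1 - ε) ^ ℓ)⁻¹ * β ℓ * (ℓ.choose k : ℝ)) *
        ((s : ℝ) ^ 2 / (N : ℝ)) * ∫ W, |g W| := by
  have hM1 : 1 ≤ M := by
    by_contra h
    have hM0 : M = 0 := by omega
    simp [hM0] at hβ1
  have hMε : (M : ℝ) ≤ ε * N := by
    rw [div_le_iff₀ hε0] at hMN
    linarith
  have hN : 0 < N := by
    rcases Nat.eq_zero_or_pos N with h | h
    · have : (1 : ℝ) ≤ M := by exact_mod_cast hM1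
      rw [h, Nat.cast_zero, mul_zero] at hMε
      linarith
    · exact h
  have hε : 0 < 1 - ε := by linarith
  have hg0 : 0 ≤ ∫ W, |g W| := integral_nonneg fun _ => abs_nonneg _
  by_cases hskN : s + k ≤ N
  swap
  · simp only [bbgkyR, if_neg hskN, abs_zero, integral_zero]
    have hsum : 0 ≤ ∑ ℓ ∈ Finset.Icc (k + 2) M, ((1 - ε) ^ ℓ)⁻¹ * β ℓ * (ℓ.choose k : ℝ) :=
      Finset.sum_nonneg fun ℓ _ => mul_nonneg (mul_nonneg (by positivity) (hβ ℓ)) (by positivity)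
    positivity
  simp only [bbgkyR, if_pos hskN]
  set w : ℕ → ℝ := fun n =>
    β (k + n) * ((N : ℝ) / (N.choose (k + n) : ℝ)) * ((N - s).choose k : ℝ) with hw
  have hw0 : ∀ n, 0 ≤ w n := fun n =>
    mul_nonneg (mul_nonneg (hβ _) (by positivity)) (by positivity)
  have hterm : ∀ n ∈ Finset.Icc 2 (M - k), ∀ i : Fin n → Fin s,
      Integrable (fun V => if StrictMono i then
          collOp b T s n k (k + n) (Nat.add_comm k n) i g V else 0) ∧
        ∫ V, |if StrictMono i then collOp b T s n k (k + n) (Nat.add_comm k n) i g V else 0| ≤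
          if StrictMono i then 2 * ∫ W, |g W| else 0 := by
    intro n hn i
    rw [Finset.mem_Icc] at hn
    by_cases hi : StrictMono i
    · simp only [if_pos hi]
      exact integrable_collOp hmeas h1 _ (by omega) (by omega) hi.injective hg
    · simp [if_neg hi]
  have hinner : ∀ n ∈ Finset.Icc 2 (M - k),
      Integrable (fun V => ∑ i : Fin n → Fin s, |if StrictMono i then
        collOp b T s n k (k + n) (Nat.add_comm k n) i g V else 0|) := fun n hn =>
    integrable_finsetSum _ fun i _ => (hterm n hn i).1.abs
  calc _ ≤ ∫ V, ∑ n ∈ Finset.Icc 2 (M - k), w n * ∑ i : Fin n → Fin s, |if StrictMono i then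
          collOp b T s n k (k + n) (Nat.add_comm k n) i g V else 0| := by
        refine integral_mono_of_nonneg (ae_of_all _ fun _ => abs_nonneg _)
          (integrable_finsetSum _ fun n hn => (hinner n hn).const_mul _) (ae_of_all _ fun V => ?_)
        refine (Finset.abs_sum_le_sum_abs _ _).trans (Finset.sum_le_sum fun n _ => ?_)
        rw [abs_mul, abs_of_nonneg (hw0 n)]
        exact mul_le_mul_of_nonneg_left (Finset.abs_sum_le_sum_abs _ _) (hw0 n)
    _ = ∑ n ∈ Finset.Icc 2 (M - k), w n * ∑ i : Fin n → Fin s, ∫ V, |if StrictMono i then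
          collOp b T s n k (k + n) (Nat.add_comm k n) i g V else 0| := by
        rw [integral_finsetSum _ fun n hn => (hinner n hn).const_mul _]
        refine Finset.sum_congr rfl fun n hn => ?_
        rw [integral_const_mul, integral_finsetSum _ fun i _ => (hterm n hn i).1.abs]
    _ ≤ ∑ n ∈ Finset.Icc 2 (M - k), w n * ((s.choose n : ℝ) * (2 * ∫ W, |g W|)) := by
        refine Finset.sum_le_sum fun n hn => mul_le_mul_of_nonneg_left ?_ (hw0 n)
        refine (Finset.sum_le_sum fun i _ => (hterm n hn i).2).trans ?_
        rw [← Finset.sum_filter, Finset.sum_const, nsmul_eq_mul]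
        exact mul_le_mul_of_nonneg_right (by exact_mod_cast card_strictMono_le_choose n s)
          (by positivity)
    _ ≤ ∑ n ∈ Finset.Icc 2 (M - k),
          (((1 - ε) ^ (k + n))⁻¹ * β (k + n) * ((k + n).choose k : ℝ)) *
            (2 * ((s : ℝ) ^ 2 / N) * ∫ W, |g W|) := by
        refine Finset.sum_le_sum fun n hn => ?_
        rw [Finset.mem_Icc] at hn
        have hℓ : ((k + n : ℕ) : ℝ) ≤ ε * N :=
          le_trans (by exact_mod_cast (by omega : k + n ≤ M)) hMε
        have h := mul_le_mul_of_nonneg_right (choose_weight_le hε1 hN hℓ hsN hn.1)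
          (mul_nonneg (hβ (k + n)) (mul_nonneg zero_le_two hg0))
        simp only [hw]
        linarith
    _ = ∑ ℓ ∈ Finset.Icc (k + 2) M, (((1 - ε) ^ ℓ)⁻¹ * β ℓ * (ℓ.choose k : ℝ)) *
            (2 * ((s : ℝ) ^ 2 / N) * ∫ W, |g W|) := by
        refine Finset.sum_bij (fun n _ => k + n) ?_ ?_ ?_ fun _ _ => rfl
        · intro n hn
          rw [Finset.mem_Icc] at hn ⊢
          omega
        · intro m _ n _ h
          omega
        · intro ℓ hℓ
          rw [Finset.mem_Icc] at hℓ
          exact ⟨ℓ - k, by rw [Finset.mem_Icc]; omega, by omega⟩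
    _ = _ := by
        rw [← Finset.sum_mul]
        ring
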